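/- For ζ in the closed unit disk and r ∈ [0,1), every f ∈ H² satisfies D_ζ(f_r) ≤ (2r/(1+r)) · D_ζ(f), where f_r(z) = f(rz) and D_ζ is the local Dirichlet integral at ζ. Consequently, for any finite positive Borel measure μ on the closed unit disk, D_μ(f_r) ≤ (2r/(1+r)) · D_μ(f), where D_μ(f) = ∫ D_ζ(f) dμ(ζ). -/

import Mathlib

open Complex Metric MeasureTheory Real
open scoped ENNReal

/-- `n`-th Taylor coefficient at `0` of a function holomorphic on the unit disk. -/
noncomputable def hcoeff (f : ℂ → ℂ) (n : ℕ) : ℂ := iteratedDeriv n f 0 / (n.factorial : ℂ)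

/-- Membership in the Hardy space `H²` of the unit disk. -/
def MemH2 (f : ℂ → ℂ) : Prop :=
  DifferentiableOn ℂ f (Metric.ball (0 : ℂ) 1) ∧ Summable fun n : ℕ => ‖hcoeff f n‖ ^ 2

/-- The local Dirichlet integral `D_ζ(f)` (valued in `[0,∞]`, normalized area measure):
for `ζ ∈ 𝔻` it is `(2/(1−|ζ|²)) ∫_𝔻 log|(1−conj ζ·z)/(ζ−z)| |f′|² dA`, and for `ζ ∈ 𝕋`
it is `∫_𝔻 ((1−|z|²)/|ζ−z|²) |f′|² dA`. -/
noncomputable def locDir (ζ : ℂ) (f : ℂ → ℂ) : ℝ≥0∞ :=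
  if ‖ζ‖ < 1 then
    ∫⁻ z in Metric.ball (0 : ℂ) 1,
      ENNReal.ofReal (2 / (1 - ‖ζ‖ ^ 2) *
        Real.log ‖(1 - (starRingEnd ℂ) ζ * z) / (ζ - z)‖ * ‖deriv f z‖ ^ 2 / π)
  else
    ∫⁻ z in Metric.ball (0 : ℂ) 1,
      ENNReal.ofReal ((1 - ‖z‖ ^ 2) / ‖ζ - z‖ ^ 2 * ‖deriv f z‖ ^ 2 / π)


lemma aux_parseval_poly (c : ℕ → ℂ) (N : ℕ) :
    ∫ θ in (0:ℝ)..(2*π), ‖∑ n ∈ Finset.range N, c n * (Complex.exp (θ * I)) ^ n‖ ^ 2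
      = 2 * π * ∑ n ∈ Finset.range N, ‖c n‖ ^ 2 := by
  have h := Polynomial.sum_sq_norm_coeff_eq_circleAverage
    (p := ∑ n ∈ Finset.range N, Polynomial.monomial n (c n))
  have h1 : ∀ i, (∑ n ∈ Finset.range N, Polynomial.monomial n (c n)).coeff i
      = if i < N then c i else 0 := by
    intro i
    simp [Polynomial.coeff_monomial]
  rw [Finset.sum_subset (s₂ := Finset.range N)] at h
  · rw [Finset.sum_congr rfl (g := fun n => ‖c n‖ ^ 2)] at h
    · rw [h, Real.circleAverage]
      simp only [Polynomial.eval_finsetSum, Polynomial.eval_monomial, circleMap, smul_eq_mul]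
      rw [← mul_assoc, mul_inv_cancel₀ (by positivity), one_mul]
      simp
    · intro i hi
      rw [h1, if_pos (Finset.mem_range.1 hi)]
  · intro i hi
    rw [Polynomial.mem_support_iff, h1] at hi
    simp at hi ⊢
    exact hi.1
  · intro i hi h2
    rw [Polynomial.notMem_support_iff] at h2
    simp [h2]

lemma aux_parseval_int (c : ℕ → ℂ) (hc : Summable fun n => ‖c n‖) :
    ∫ θ in (0:ℝ)..(2*π), ‖∑' n, c n * (Complex.exp (θ * I)) ^ n‖ ^ 2
      = 2 * π * ∑' n, ‖c n‖ ^ 2 := by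
  have hn : ∀ (θ : ℝ) n, ‖c n * (Complex.exp (θ * I)) ^ n‖ = ‖c n‖ := by
    intro θ n; simp [Complex.norm_exp_ofReal_mul_I]
  have hs : ∀ θ : ℝ, Summable fun n => c n * (Complex.exp (θ * I)) ^ n := by
    intro θ
    apply Summable.of_norm
    simpa only [hn] using hc
  have hsq : Summable fun n => ‖c n‖ ^ 2 := by
    refine Summable.of_nonneg_of_le (fun n => by positivity) (fun n => ?_)
      (hc.mul_left (∑' n, ‖c n‖))
    rw [sq]
    exact mul_le_mul_of_nonneg_right (hc.le_tsum n (fun _ _ => norm_nonneg _)) (norm_nonneg _)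
  have t1 : Filter.Tendsto (fun N => ∫ θ in (0:ℝ)..(2*π),
      ‖∑ n ∈ Finset.range N, c n * (Complex.exp (θ * I)) ^ n‖ ^ 2) Filter.atTop
      (nhds (∫ θ in (0:ℝ)..(2*π), ‖∑' n, c n * (Complex.exp (θ * I)) ^ n‖ ^ 2)) := by
    apply intervalIntegral.tendsto_integral_filter_of_dominated_convergence
      (fun _ => (∑' n, ‖c n‖) ^ 2)
    · refine Filter.Eventually.of_forall fun N => ?_
      apply Continuous.aestronglyMeasurable
      fun_prop
    · refine Filter.Eventually.of_forall fun N => Filter.Eventually.of_forall fun θ _ => ?_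
      rw [norm_pow, norm_norm]
      gcongr
      refine (norm_sum_le _ _).trans ?_
      simp only [hn]
      exact hc.sum_le_tsum _ (fun _ _ => norm_nonneg _)
    · simp
    · refine Filter.Eventually.of_forall fun θ _ => ?_
      exact ((hs θ).hasSum.tendsto_sum_nat.norm).pow 2
  simp only [aux_parseval_poly] at t1
  exact tendsto_nhds_unique t1 (hsq.hasSum.tendsto_sum_nat.const_mul _)

lemma aux_parseval (c : ℕ → ℂ) (hc : Summable fun n => ‖c n‖) :
    ∫⁻ θ in Set.Ioo (-π) π, ENNReal.ofReal (‖∑' n, c n * (Complex.exp (θ * I)) ^ n‖ ^ 2)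
      = ENNReal.ofReal (2 * π) * ∑' n, ENNReal.ofReal (‖c n‖ ^ 2) := by
  have hn : ∀ (θ : ℝ) n, ‖c n * (Complex.exp (θ * I)) ^ n‖ = ‖c n‖ := by
    intro θ n; simp [Complex.norm_exp_ofReal_mul_I]
  have hsq : Summable fun n => ‖c n‖ ^ 2 := by
    refine Summable.of_nonneg_of_le (fun n => by positivity) (fun n => ?_)
      (hc.mul_left (∑' n, ‖c n‖))
    rw [sq]
    exact mul_le_mul_of_nonneg_right (hc.le_tsum n (fun _ _ => norm_nonneg _)) (norm_nonneg _)
  have hcont : Continuous fun θ : ℝ => ‖∑' n, c n * (Complex.exp (θ * I)) ^ n‖ ^ 2 := by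
    apply Continuous.pow
    apply Continuous.norm
    exact continuous_tsum (fun n => by fun_prop) hc (fun n θ => (hn θ n).le)
  have hper : Function.Periodic (fun θ : ℝ => ‖∑' n, c n * (Complex.exp (θ * I)) ^ n‖ ^ 2)
      (2 * π) := by
    intro θ
    have : Complex.exp (((θ + 2 * π : ℝ) : ℂ) * I) = Complex.exp (θ * I) := by
      push_cast
      rw [add_mul, Complex.exp_periodic]
    simp only [this]
  have h0 := aux_parseval_int c hc
  have h1 := hper.intervalIntegral_add_eq (-π) 0
  rw [show -π + 2 * π = π by ring, zero_add] at h1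
  rw [← h1] at h0
  rw [← ENNReal.ofReal_tsum_of_nonneg (fun n => by positivity) hsq,
    ← ENNReal.ofReal_mul (by positivity), ← h0,
    intervalIntegral.integral_of_le (by linarith [Real.pi_pos]),
    MeasureTheory.integral_Ioc_eq_integral_Ioo,
    MeasureTheory.ofReal_integral_eq_lintegral_ofReal]
  · exact (hcont.integrableOn_Icc (a := -π) (b := π)).mono_set Set.Ioo_subset_Icc_self
  · exact Filter.Eventually.of_forall fun θ => by positivity

lemma aux_disk (b : ℕ → ℂ) (R : ℝ) (hR : 0 < R)
    (hb : ∀ z : ℂ, ‖z‖ < R → Summable fun n => ‖b n * z ^ n‖) (φ : ℝ → ℝ≥0∞)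
    (hφ : Measurable φ) (F : ℂ → ℂ) (hFm : Measurable F)
    (hF : ∀ z : ℂ, ‖z‖ < R → F z = ∑' n, b n * z ^ n) :
    ∫⁻ z in ball (0:ℂ) R, φ ‖z‖ * ENNReal.ofReal (‖F z‖ ^ 2)
      = ∑' n, ENNReal.ofReal (‖b n‖ ^ 2) *
        ∫⁻ ρ in Set.Ioo 0 R, φ ρ * ENNReal.ofReal (2 * π * ρ ^ (2 * n + 1)) := by
  have hexp : ∀ p : ℝ × ℝ, Complex.polarCoord.symm p = p.1 * Complex.exp (p.2 * I) := by
    intro p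
    rw [Complex.polarCoord_symm_apply, Complex.exp_mul_I]
    push_cast; rfl
  have hGm : Measurable fun p : ℝ × ℝ => ENNReal.ofReal p.1 *
      (ball (0:ℂ) R).indicator (fun z => φ ‖z‖ * ENNReal.ofReal (‖F z‖ ^ 2))
        (p.1 * Complex.exp (p.2 * I)) := by
    apply Measurable.mul (by fun_prop)
    have hm : Measurable ((ball (0:ℂ) R).indicator
        (fun z => φ ‖z‖ * ENNReal.ofReal (‖F z‖ ^ 2))) := by
      apply Measurable.indicator _ measurableSet_ball
      fun_prop
    exact hm.comp (by fun_prop)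
  rw [← lintegral_indicator measurableSet_ball, ← Complex.lintegral_comp_polarCoord_symm]
  simp only [hexp, smul_eq_mul]
  rw [polarCoord_target, Measure.volume_eq_prod, ← Measure.prod_restrict,
    lintegral_prod _ hGm.aemeasurable]
  have key : ∀ ρ ∈ Set.Ioi (0:ℝ), ∫⁻ θ in Set.Ioo (-π) π, ENNReal.ofReal ρ *
      (ball (0:ℂ) R).indicator (fun z => φ ‖z‖ * ENNReal.ofReal (‖F z‖ ^ 2))
        (ρ * Complex.exp (θ * I)) = (Set.Iio R).indicator (fun ρ => ∑' n,
          ENNReal.ofReal (‖b n‖ ^ 2) *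
          (φ ρ * ENNReal.ofReal (2 * π * ρ ^ (2 * n + 1)))) ρ := by
    intro ρ hρ
    have hρ0 : 0 < ρ := hρ
    have hnorm : ∀ θ : ℝ, ‖(ρ:ℂ) * Complex.exp (θ * I)‖ = ρ := by
      intro θ; simp [Complex.norm_exp_ofReal_mul_I, hρ0.le]
    by_cases hlt : ρ < R
    · rw [Set.indicator_of_mem (show ρ ∈ Set.Iio R from hlt)]
      have e1 : ∀ θ : ℝ, ENNReal.ofReal ρ *
          (ball (0:ℂ) R).indicator (fun z => φ ‖z‖ * ENNReal.ofReal (‖F z‖ ^ 2))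
          (ρ * Complex.exp (θ * I)) = (ENNReal.ofReal ρ * φ ρ) *
          ENNReal.ofReal (‖∑' n, (b n * (ρ:ℂ) ^ n) * (Complex.exp (θ * I)) ^ n‖ ^ 2) := by
        intro θ
        rw [Set.indicator_of_mem (by rw [mem_ball_zero_iff, hnorm]; exact hlt), hnorm,
          hF _ (by rw [hnorm]; exact hlt), mul_assoc]
        simp only [mul_pow, mul_assoc]
      simp only [e1]
      have hc : Summable fun n => ‖b n * (ρ:ℂ) ^ n‖ := hb ρ (by simpa [abs_of_pos hρ0] using hlt)
      have hm : Measurable fun θ : ℝ => ENNReal.ofReal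
          (‖∑' n, (b n * (ρ:ℂ) ^ n) * (Complex.exp (θ * I)) ^ n‖ ^ 2) := by
        have : Continuous fun θ : ℝ => ∑' n, (b n * (ρ:ℂ) ^ n) * (Complex.exp (θ * I)) ^ n :=
          continuous_tsum (fun n => by fun_prop) hc
            (fun n θ => by simp [Complex.norm_exp_ofReal_mul_I])
        fun_prop
      rw [lintegral_const_mul _ hm, aux_parseval _ hc, ← ENNReal.tsum_mul_left,
        ← ENNReal.tsum_mul_left]
      congr 1; ext n
      have e2 : ‖b n * (ρ:ℂ) ^ n‖ ^ 2 = ‖b n‖ ^ 2 * ρ ^ (2 * n) := by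
        simp only [norm_mul, norm_pow, Complex.norm_real, Real.norm_eq_abs, abs_of_pos hρ0]
        ring
      rw [e2, show 2 * π * ρ ^ (2 * n + 1) = ρ * ((2 * π) * ρ ^ (2 * n)) by ring,
        ENNReal.ofReal_mul (p := ‖b n‖ ^ 2) (by positivity),
        ENNReal.ofReal_mul (p := ρ) (by positivity),
        ENNReal.ofReal_mul (p := 2 * π) (q := ρ ^ (2 * n)) (by positivity)]
      ring
    · rw [Set.indicator_of_notMem (by simpa using hlt)]
      have e1 : ∀ θ : ℝ, ENNReal.ofReal ρ *
          (ball (0:ℂ) R).indicator (fun z => φ ‖z‖ * ENNReal.ofReal (‖F z‖ ^ 2))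
          (ρ * Complex.exp (θ * I)) = 0 := by
        intro θ
        rw [Set.indicator_of_notMem (by rw [mem_ball_zero_iff, hnorm]; exact hlt), mul_zero]
      simp only [e1]
      simp
  rw [setLIntegral_congr_fun measurableSet_Ioi key, lintegral_indicator measurableSet_Iio,
    Measure.restrict_restrict measurableSet_Iio, Set.inter_comm, Set.Ioi_inter_Iio,
    lintegral_tsum (fun n => by fun_prop)]
  congr 1; ext n
  rw [lintegral_const_mul _ (by fun_prop)]

/-- Coefficients of `g(z)/(1-uz)` where `g = ∑ d n z^n`. -/
noncomputable def auxB (u : ℂ) (d : ℕ → ℂ) (n : ℕ) : ℂ :=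
  ∑ k ∈ Finset.range (n + 1), d k * u ^ (n - k)

lemma auxB_zero (u : ℂ) (d : ℕ → ℂ) : auxB u d 0 = d 0 := by simp [auxB]

lemma auxB_succ (u : ℂ) (d : ℕ → ℂ) (n : ℕ) : auxB u d (n + 1) = u * auxB u d n + d (n + 1) := by
  unfold auxB
  rw [Finset.sum_range_succ _ (n + 1), Finset.mul_sum]
  congr 1
  · apply Finset.sum_congr rfl
    intro k hk
    have : n + 1 - k = (n - k) + 1 := by
      have := Finset.mem_range.1 hk
      omega
    rw [this]; ring
  · simp

/-- The auxiliary remainder. -/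
noncomputable def auxL (r t : ℝ) (b : ℕ → ℝ) : ℕ → ℝ
  | 0 => 0
  | n + 1 => t * (auxL r t b n + (1 - r) * r ^ (n + 1) * b n)

lemma auxL_nonneg (r t : ℝ) (hr : 0 ≤ r) (hr1 : r < 1) (ht : 0 ≤ t) (b : ℕ → ℝ)
    (hb : ∀ n, 0 ≤ b n) (n : ℕ) : 0 ≤ auxL r t b n := by
  induction n with
  | zero => simp [auxL]
  | succ n ih =>
    have := hb n
    have : 0 ≤ 1 - r := by linarith
    simp only [auxL]; positivity

lemma aux_cs (x y : ℂ) (A L c B : ℝ) (hA : 0 ≤ A) (hL : 0 ≤ L) (hc : 0 ≤ c)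
    (hx : ‖x‖ ^ 2 ≤ A * L) (hB : ‖y‖ ^ 2 = B) : ‖x + c * y‖ ^ 2 ≤ (A + c) * (L + c * B) := by
  have h1 : ‖x + c * y‖ ≤ ‖x‖ + c * ‖y‖ := by
    refine (norm_add_le _ _).trans ?_
    simp [abs_of_nonneg hc]
  have h2 : ‖x + c * y‖ ^ 2 ≤ (‖x‖ + c * ‖y‖) ^ 2 := by gcongr
  refine h2.trans ?_
  subst hB
  have hn := norm_nonneg x
  have hm := norm_nonneg y
  -- 2 c |x||y| ≤ A c |y|^2 + c L
  have h3 : 2 * (‖x‖ * ‖y‖) ≤ A * ‖y‖ ^ 2 + L := by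
    have : (2 * (‖x‖ * ‖y‖)) ^ 2 ≤ (A * ‖y‖ ^ 2 + L) ^ 2 := by
      nlinarith [sq_nonneg (A * ‖y‖ ^ 2 - L), mul_le_mul_of_nonneg_right hx (sq_nonneg ‖y‖)]
    exact le_of_sq_le_sq this (by positivity)
  nlinarith [mul_le_mul_of_nonneg_left h3 hc]

lemma aux_lambda (r : ℝ) (hr : 0 ≤ r) (hr1 : r < 1) (u : ℂ) (d : ℕ → ℂ) (n : ℕ) :
    ‖auxB u (fun n => (r:ℂ) ^ (n + 1) * d n) n - (r:ℂ) ^ (n + 1) * auxB u d n‖ ^ 2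
      ≤ (r - r ^ (n + 1)) * auxL r (‖u‖ ^ 2) (fun n => ‖auxB u d n‖ ^ 2) n := by
  induction n with
  | zero => simp [auxL, auxB_zero]
  | succ n ih =>
    set lam := auxB u (fun n => (r:ℂ) ^ (n + 1) * d n) n - (r:ℂ) ^ (n + 1) * auxB u d n with hlam
    have e : auxB u (fun n => (r:ℂ) ^ (n + 1) * d n) (n + 1)
        - (r:ℂ) ^ (n + 1 + 1) * auxB u d (n + 1)
        = u * (lam + (((1 - r) * r ^ (n + 1) : ℝ) : ℂ) * auxB u d n) := by
      rw [auxB_succ, auxB_succ, hlam]; push_cast; ring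
    rw [e, norm_mul, mul_pow]
    simp only [auxL]
    have h1 : r ^ (n + 1) ≤ r := by
      simpa using pow_le_pow_of_le_one hr hr1.le (show 1 ≤ n + 1 by omega)
    have h2 : 0 ≤ 1 - r := by linarith
    have := aux_cs lam (auxB u d n) (r - r ^ (n + 1))
      (auxL r (‖u‖ ^ 2) (fun n => ‖auxB u d n‖ ^ 2) n) ((1 - r) * r ^ (n + 1)) _
      (by linarith) (auxL_nonneg r _ hr hr1 (by positivity) _ (fun n => by positivity) n)
      (by positivity) ih rfl
    calc ‖u‖ ^ 2 * _ ≤ ‖u‖ ^ 2 * _ := mul_le_mul_of_nonneg_left this (by positivity)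
      _ = _ := by ring

/-- The weights. -/
noncomputable def auxW (t R : ℝ) (n : ℕ) : ℝ :=
  R ^ (2 * n + 2) / (n + 1) - t * (R ^ (2 * n + 4) / (n + 2))

lemma auxW_ge (t R : ℝ) (hR : 0 ≤ R) (htR : t * R ^ 2 ≤ 1) (n : ℕ) :
    t * (R ^ (2 * n + 4) / (n + 2)) ≤ (n + 1) * auxW t R n := by
  unfold auxW
  have h : t * R ^ (2 * n + 4) ≤ R ^ (2 * n + 2) := by
    calc t * R ^ (2 * n + 4) = (t * R ^ 2) * R ^ (2 * n + 2) := by ring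
      _ ≤ 1 * R ^ (2 * n + 2) := by gcongr
      _ = _ := one_mul _
  have e : (n + 1) * (R ^ (2 * n + 2) / ((n:ℝ) + 1) - t * (R ^ (2 * n + 4) / ((n:ℝ) + 2)))
      - t * (R ^ (2 * n + 4) / ((n:ℝ) + 2)) = R ^ (2 * n + 2) - t * R ^ (2 * n + 4) := by
    field_simp; ring
  linarith

lemma auxW_nonneg (t R : ℝ) (hR : 0 ≤ R) (ht : 0 ≤ t) (htR : t * R ^ 2 ≤ 1) (n : ℕ) :
    0 ≤ auxW t R n := by
  have h := auxW_ge t R hR htR n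
  have h2 : 0 ≤ t * (R ^ (2 * n + 4) / ((n:ℝ) + 2)) := by positivity
  have h3 : (0:ℝ) < n + 1 := by positivity
  by_contra hc
  push Not at hc
  nlinarith

lemma aux_bern (r : ℝ) (hr : 0 ≤ r) (hr1 : r < 1) (n : ℕ) : r ^ n * (1 + n * (1 - r)) ≤ 1 := by
  induction n with
  | zero => simp
  | succ n ih =>
    refine le_trans ?_ ih
    rw [pow_succ, mul_assoc]
    apply mul_le_mul_of_nonneg_left _ (by positivity)
    push_cast
    have h1 : 0 ≤ 1 - r := by linarith
    have h2 : (0:ℝ) ≤ n := by positivity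
    nlinarith [mul_nonneg h1 h1, mul_nonneg h2 (mul_nonneg h1 h1)]

lemma aux_step (r : ℝ) (hr : 0 ≤ r) (hr1 : r < 1) (u : ℂ) (R : ℝ) (hR : 0 ≤ R)
    (huR : ‖u‖ ^ 2 * R ^ 2 ≤ 1) (d : ℕ → ℂ) (N : ℕ) :
    ∑ n ∈ Finset.range N, auxW (‖u‖ ^ 2) R n *
        ‖auxB u (fun n => (r:ℂ) ^ (n + 1) * d n) n‖ ^ 2
      + r * (R ^ (2 * N + 2) / (N + 1)) * auxL r (‖u‖ ^ 2) (fun n => ‖auxB u d n‖ ^ 2) N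
      ≤ r * ∑ n ∈ Finset.range N, auxW (‖u‖ ^ 2) R n * ‖auxB u d n‖ ^ 2 := by
  induction N with
  | zero => simp [auxL]
  | succ n ih =>
    rw [Finset.sum_range_succ, Finset.sum_range_succ]
    set S1 := ∑ n ∈ Finset.range n, auxW (‖u‖ ^ 2) R n *
        ‖auxB u (fun n => (r:ℂ) ^ (n + 1) * d n) n‖ ^ 2
    set S2 := ∑ n ∈ Finset.range n, auxW (‖u‖ ^ 2) R n * ‖auxB u d n‖ ^ 2
    set L := auxL r (‖u‖ ^ 2) (fun n => ‖auxB u d n‖ ^ 2) n with hL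
    have hL0 : 0 ≤ L := auxL_nonneg r _ hr hr1 (by positivity) _ (fun n => by positivity) n
    have hlam := aux_lambda r hr hr1 u d n
    rw [← hL] at hlam
    have h1 : r ^ (n + 1) ≤ r := by
      simpa using pow_le_pow_of_le_one hr hr1.le (show 1 ≤ n + 1 by omega)
    have hcs := aux_cs _ (auxB u d n) (r - r ^ (n + 1)) L (r ^ (n + 1)) _ (by linarith) hL0
      (by positivity) hlam rfl
    have e0 : auxB u (fun n => (r:ℂ) ^ (n + 1) * d n) n - (r:ℂ) ^ (n + 1) * auxB u d n
        + ((r ^ (n + 1) : ℝ) : ℂ) * auxB u d n = auxB u (fun n => (r:ℂ) ^ (n + 1) * d n) n := by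
      push_cast; ring
    rw [e0] at hcs
    set X := ‖auxB u (fun n => (r:ℂ) ^ (n + 1) * d n) n‖ ^ 2
    have hLs : auxL r (‖u‖ ^ 2) (fun n => ‖auxB u d n‖ ^ 2) (n + 1)
        = ‖u‖ ^ 2 * (L + (1 - r) * r ^ (n + 1) * ‖auxB u d n‖ ^ 2) := rfl
    rw [hLs]
    set B := ‖auxB u d n‖ ^ 2
    have hB : 0 ≤ B := by positivity
    set t := ‖u‖ ^ 2
    have hW := auxW_nonneg t R hR (by positivity) huR n
    have hWge := auxW_ge t R hR huR n
    have hb := aux_bern r hr hr1 (n + 1)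
    have hWdef : auxW t R n = R ^ (2 * n + 2) / (n + 1) - t * (R ^ (2 * n + 4) / (n + 2)) := rfl
    have hK : R ^ (2 * (n + 1) + 2) / (((n + 1 : ℕ) : ℝ) + 1) = R ^ (2 * n + 4) / ((n:ℝ) + 2) := by
      push_cast; congr 1; ring
    rw [hK]
    set K0 := R ^ (2 * n + 2) / ((n:ℝ) + 1)
    set K1 := R ^ (2 * n + 4) / ((n:ℝ) + 2)
    set W := auxW t R n
    set q := r ^ (n + 1)
    have hq : 0 ≤ q := by positivity
    have f1 : W * X ≤ W * (r * (L + q * B)) := by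
      apply mul_le_mul_of_nonneg_left _ hW
      calc X ≤ _ := hcs
        _ = _ := by ring
    have f2 : q * (W + (1 - r) * (t * K1)) ≤ W := by
      push_cast at hb
      have : (1 - r) * (t * K1) ≤ (1 - r) * ((n + 1) * W) :=
        mul_le_mul_of_nonneg_left hWge (by linarith)
      have h5 := mul_le_mul_of_nonneg_left this hq
      have h6 := mul_le_mul_of_nonneg_right hb hW
      nlinarith
    have f3 := mul_le_mul_of_nonneg_left (mul_le_mul_of_nonneg_right f2 hB) hr
    have f4 : W * L = K0 * L - t * K1 * L := by rw [hWdef]; ring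
    have f5 : r * (W * L) = r * (K0 * L - t * K1 * L) := by rw [f4]
    nlinarith

lemma aux_tsum (r : ℝ) (hr : 0 ≤ r) (hr1 : r < 1) (u : ℂ) (R : ℝ) (hR : 0 ≤ R)
    (huR : ‖u‖ ^ 2 * R ^ 2 ≤ 1) (d : ℕ → ℂ) :
    ∑' n, ENNReal.ofReal (‖auxB u (fun n => (r:ℂ) ^ (n + 1) * d n) n‖ ^ 2) *
        ENNReal.ofReal (auxW (‖u‖ ^ 2) R n)
      ≤ ENNReal.ofReal r * ∑' n, ENNReal.ofReal (‖auxB u d n‖ ^ 2) *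
        ENNReal.ofReal (auxW (‖u‖ ^ 2) R n) := by
  have hW := auxW_nonneg (‖u‖ ^ 2) R hR (by positivity) huR
  apply ENNReal.tsum_le_of_sum_range_le
  intro N
  refine le_trans ?_ (mul_le_mul_right (ENNReal.sum_le_tsum (Finset.range N)) _)
  simp only [← ENNReal.ofReal_mul (sq_nonneg _)]
  rw [← ENNReal.ofReal_sum_of_nonneg (fun n _ => mul_nonneg (sq_nonneg _) (hW n)),
    ← ENNReal.ofReal_sum_of_nonneg (fun n _ => mul_nonneg (sq_nonneg _) (hW n)),
    ← ENNReal.ofReal_mul hr]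
  apply ENNReal.ofReal_le_ofReal
  have h := aux_step r hr hr1 u R hR huR d N
  have hL0 : 0 ≤ auxL r (‖u‖ ^ 2) (fun n => ‖auxB u d n‖ ^ 2) N :=
    auxL_nonneg r _ hr hr1 (by positivity) _ (fun n => by positivity) N
  have h2 : 0 ≤ r * (R ^ (2 * N + 2) / (N + 1)) *
      auxL r (‖u‖ ^ 2) (fun n => ‖auxB u d n‖ ^ 2) N := by positivity
  simp only [mul_comm _ (auxW _ _ _)]
  linarith

lemma aux_moment (t R : ℝ) (hR : 0 < R) (ht : 0 ≤ t) (htR : t * R ^ 2 ≤ 1) (n : ℕ) :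
    ∫⁻ ρ in Set.Ioo 0 R, ENNReal.ofReal ((1 - t * ρ ^ 2) / π) *
      ENNReal.ofReal (2 * π * ρ ^ (2 * n + 1)) = ENNReal.ofReal (auxW t R n) := by
  have hpos : ∀ ρ ∈ Set.Ioo 0 R, 0 ≤ 1 - t * ρ ^ 2 := by
    intro ρ hρ
    have : t * ρ ^ 2 ≤ t * R ^ 2 := by
      have := hρ.1.le; have := hρ.2.le
      gcongr
    linarith
  have e1 : ∀ ρ ∈ Set.Ioo 0 R, ENNReal.ofReal ((1 - t * ρ ^ 2) / π) *
      ENNReal.ofReal (2 * π * ρ ^ (2 * n + 1))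
      = ENNReal.ofReal (2 * ρ ^ (2 * n + 1) - 2 * t * ρ ^ (2 * n + 3)) := by
    intro ρ hρ
    rw [← ENNReal.ofReal_mul (div_nonneg (hpos ρ hρ) Real.pi_pos.le)]
    congr 1
    field_simp
    ring
  rw [setLIntegral_congr_fun measurableSet_Ioo e1, ← ofReal_integral_eq_lintegral_ofReal]
  · congr 1
    rw [← integral_Ioc_eq_integral_Ioo, ← intervalIntegral.integral_of_le hR.le,
      intervalIntegral.integral_sub (by apply Continuous.intervalIntegrable; fun_prop)
        (by apply Continuous.intervalIntegrable; fun_prop),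
      intervalIntegral.integral_const_mul, intervalIntegral.integral_const_mul,
      integral_pow, integral_pow]
    unfold auxW
    push_cast
    simp only [show 2 * n + 1 + 1 = 2 * n + 2 by ring, show 2 * n + 3 + 1 = 2 * n + 4 by ring]
    field_simp
    ring_nf
  · apply IntegrableOn.mono_set (t := Set.Icc 0 R) _ Set.Ioo_subset_Icc_self
    apply Continuous.integrableOn_Icc
    fun_prop
  · refine (ae_restrict_iff' measurableSet_Ioo).2 (Filter.Eventually.of_forall fun ρ hρ => ?_)
    have h1 := hpos ρ hρ
    have h2 := hρ.1
    have : 2 * ρ ^ (2 * n + 1) - 2 * t * ρ ^ (2 * n + 3)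
      = 2 * ρ ^ (2 * n + 1) * (1 - t * ρ ^ 2) := by ring
    simp only [Pi.zero_apply]
    rw [this]; positivity

/-- Dirichlet type integral with the weight `(1-|uz|²)/|1-uz|²` on the disk of radius `R`. -/
noncomputable def auxE (u : ℂ) (R : ℝ) (f : ℂ → ℂ) : ℝ≥0∞ :=
  ∫⁻ z in ball (0:ℂ) R,
    ENNReal.ofReal ((1 - ‖u * z‖ ^ 2) / ‖1 - u * z‖ ^ 2 * ‖deriv f z‖ ^ 2 / π)

lemma auxE_eq (u : ℂ) (R : ℝ) (hR : 0 < R) (huR : ‖u‖ * R ≤ 1) (f : ℂ → ℂ) (d : ℕ → ℂ)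
    (hd : ∀ z : ℂ, ‖z‖ < R → HasSum (fun n => d n * z ^ n) (deriv f z)) :
    auxE u R f = ∑' n, ENNReal.ofReal (‖auxB u d n‖ ^ 2) *
        ENNReal.ofReal (auxW (‖u‖ ^ 2) R n) := by
  have huR2 : ‖u‖ ^ 2 * R ^ 2 ≤ 1 := by
    rw [← mul_pow]; exact pow_le_one₀ (by positivity) huR
  have huz : ∀ z : ℂ, ‖z‖ < R → ‖u * z‖ < 1 := by
    intro z hz
    rw [norm_mul]
    rcases eq_or_lt_of_le (norm_nonneg u) with h | h
    · rw [← h]; simp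
    · exact (mul_lt_mul_of_pos_left hz h).trans_le huR
  have hcoef : ∀ (z : ℂ) n, ∑ k ∈ Finset.range (n + 1), d k * z ^ k * (u * z) ^ (n - k)
      = auxB u d n * z ^ n := by
    intro z n
    unfold auxB
    rw [Finset.sum_mul]
    refine Finset.sum_congr rfl fun k hk => ?_
    have : n = k + (n - k) := by have := Finset.mem_range.1 hk; omega
    conv_rhs => rw [this]
    rw [mul_pow, pow_add]
    simp only [Nat.add_sub_cancel_left]
    ring
  have hg : ∀ z : ℂ, ‖z‖ < R → Summable fun n => ‖(u * z) ^ n‖ := by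
    intro z hz
    simp only [norm_pow]
    exact summable_geometric_of_lt_one (norm_nonneg _) (huz z hz)
  have hds : ∀ z : ℂ, ‖z‖ < R → Summable fun n => ‖d n * z ^ n‖ :=
    fun z hz => (hd z hz).summable.norm
  have hm := aux_disk (auxB u d) R hR (fun z hz => by
      have := summable_norm_sum_mul_range_of_summable_norm (hds z hz) (hg z hz)
      simpa only [hcoef] using this)
    (fun ρ => ENNReal.ofReal ((1 - ‖u‖ ^ 2 * ρ ^ 2) / π)) (by fun_prop)
    (fun z => deriv f z / (1 - u * z)) ((measurable_deriv f).div (by fun_prop))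
    (fun z hz => by
      have := tsum_mul_tsum_eq_tsum_sum_range_of_summable_norm (hds z hz) (hg z hz)
      simp only [hcoef] at this
      rw [← this, (hd z hz).tsum_eq, tsum_geometric_of_norm_lt_one (huz z hz)]
      rfl)
  simp only [aux_moment (‖u‖ ^ 2) R hR (by positivity) huR2] at hm
  rw [← hm]
  unfold auxE
  refine setLIntegral_congr_fun measurableSet_ball fun z hz => ?_
  have h1 := huz z (mem_ball_zero_iff.1 hz)
  have h2 : 0 ≤ 1 - ‖u‖ ^ 2 * ‖z‖ ^ 2 := by
    rw [← mul_pow, ← norm_mul]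
    have := pow_le_one₀ (n := 2) (norm_nonneg _) h1.le
    linarith
  rw [← ENNReal.ofReal_mul (div_nonneg h2 Real.pi_pos.le)]
  congr 1
  rw [norm_div, norm_mul]
  ring

lemma auxE_le (u : ℂ) (R : ℝ) (hR : 0 < R) (hR1 : R ≤ 1) (huR : ‖u‖ * R ≤ 1) (f : ℂ → ℂ)
    (hf : DifferentiableOn ℂ f (ball (0:ℂ) 1)) (r : ℝ) (hr : 0 ≤ r) (hr1 : r < 1) :
    auxE u R (fun z => f ((r:ℂ) * z)) ≤ ENNReal.ofReal r * auxE u R f := by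
  have huR2 : ‖u‖ ^ 2 * R ^ 2 ≤ 1 := by
    rw [← mul_pow]; exact pow_le_one₀ (by positivity) huR
  have hdf := hf.deriv isOpen_ball
  set d : ℕ → ℂ := fun n => (n.factorial : ℂ)⁻¹ * iteratedDeriv n (deriv f) 0 with hddef
  have hd : ∀ z : ℂ, ‖z‖ < 1 → HasSum (fun n => d n * z ^ n) (deriv f z) := by
    intro z hz
    have := Complex.hasSum_taylorSeries_on_ball hdf (mem_ball_zero_iff.2 hz)
    have e : (fun n => d n * z ^ n)
        = fun n : ℕ => (n.factorial : ℂ)⁻¹ • (z - 0) ^ n • iteratedDeriv n (deriv f) 0 := by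
      funext n
      simp only [hddef, smul_eq_mul, sub_zero]
      ring
    rw [e]
    exact this
  have hrz : ∀ z : ℂ, ‖z‖ < R → ‖(r:ℂ) * z‖ < 1 := by
    intro z hz
    rw [norm_mul, Complex.norm_real, Real.norm_eq_abs, abs_of_nonneg hr]
    nlinarith [norm_nonneg z]
  have hd2 : ∀ z : ℂ, ‖z‖ < R → HasSum (fun n => (r:ℂ) ^ (n + 1) * d n * z ^ n)
      (deriv (fun z => f ((r:ℂ) * z)) z) := by
    intro z hz
    have h1 : HasDerivAt f (deriv f ((r:ℂ) * z)) ((r:ℂ) * z) :=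
      (hf.differentiableAt (isOpen_ball.mem_nhds (mem_ball_zero_iff.2 (hrz z hz)))).hasDerivAt
    have h2 : HasDerivAt (fun z => f ((r:ℂ) * z)) (deriv f ((r:ℂ) * z) * r) z := by
      have h3 : HasDerivAt (fun z : ℂ => (r:ℂ) * z) (r:ℂ) z := by
        simpa using (hasDerivAt_id z).const_mul (r:ℂ)
      exact h1.comp z h3
    rw [h2.deriv]
    have e : (fun n => (r:ℂ) ^ (n + 1) * d n * z ^ n)
        = fun n => d n * ((r:ℂ) * z) ^ n * (r:ℂ) := by
      funext n
      ring
    rw [e]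
    exact (hd _ (hrz z hz)).mul_right (r:ℂ)
  rw [auxE_eq u R hR huR f d (fun z hz => hd z (hz.trans_le hR1)),
    auxE_eq u R hR huR _ _ hd2]
  exact aux_tsum r hr hr1 u R hR.le huR2 d

lemma aux_log (z ζ : ℂ) (hz : ‖z‖ < 1) (hζ : ‖ζ‖ < 1) (hne : ‖z‖ ≠ ‖ζ‖) :
    ENNReal.ofReal (Real.log ‖(1 - (starRingEnd ℂ) ζ * z) / (ζ - z)‖)
      = ∫⁻ R in Set.Ioo ‖ζ‖ 1, (if ‖z‖ < R then ENNReal.ofReal (1 / R *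
          ((1 - ‖(starRingEnd ℂ) ζ / (R:ℂ) ^ 2 * z‖ ^ 2) /
            ‖1 - (starRingEnd ℂ) ζ / (R:ℂ) ^ 2 * z‖ ^ 2)) else 0) := by
  set m := max ‖z‖ ‖ζ‖ with hm
  have hm1 : m < 1 := max_lt hz hζ
  have hm0 : 0 < m := by
    rcases lt_or_gt_of_ne hne with h | h
    · exact lt_of_lt_of_le ((norm_nonneg z).trans_lt h) (le_max_right _ _)
    · exact lt_of_lt_of_le ((norm_nonneg ζ).trans_lt h) (le_max_left _ _)
  set w := (starRingEnd ℂ) ζ * z with hw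
  have hwm : ‖w‖ < m ^ 2 := by
    rw [hw, norm_mul, RCLike.norm_conj, sq]
    have h1 : ‖ζ‖ ≤ m := le_max_right _ _
    have h2 : ‖z‖ ≤ m := le_max_left _ _
    rcases lt_or_gt_of_ne hne with h | h
    · have h3 : ‖z‖ < m := lt_of_lt_of_le h h1
      nlinarith [norm_nonneg z, norm_nonneg ζ]
    · have h3 : ‖ζ‖ < m := lt_of_lt_of_le h h2
      nlinarith [norm_nonneg z, norm_nonneg ζ]
  have hwsq : ‖w‖ ^ 2 = w.re ^ 2 + w.im ^ 2 := by
    rw [← Complex.normSq_eq_norm_sq, Complex.normSq_apply]; ring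
  have hQ : ∀ R : ℝ, ‖((R:ℂ) ^ 2 - w)‖ ^ 2 = (R ^ 2 - w.re) ^ 2 + w.im ^ 2 := by
    intro R
    rw [← Complex.normSq_eq_norm_sq, Complex.normSq_apply]
    simp [← Complex.ofReal_pow]; ring
  have hwR : ∀ R, m ≤ R → ‖w‖ < R ^ 2 := fun R hR => hwm.trans_le (by gcongr)
  have hQpos : ∀ R, m ≤ R → 0 < (R ^ 2 - w.re) ^ 2 + w.im ^ 2 := by
    intro R hR
    have h1 : w.re < R ^ 2 := (Complex.re_le_norm w).trans_lt (hwR R hR)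
    have : 0 < R ^ 2 - w.re := by linarith
    positivity
  set p : ℝ → ℝ := fun R => (R ^ 4 - ‖w‖ ^ 2) / (R * ((R ^ 2 - w.re) ^ 2 + w.im ^ 2)) with hp
  have hp0 : ∀ R, m ≤ R → 0 ≤ p R := by
    intro R hR
    have hR0 : 0 < R := hm0.trans_le hR
    have h1 : ‖w‖ ^ 2 ≤ (R ^ 2) ^ 2 := by
      have := hwR R hR
      gcongr
    have h2 : 0 ≤ R ^ 4 - ‖w‖ ^ 2 := by nlinarith
    have := hQpos R hR
    simp only [hp]; positivity
  have hderiv : ∀ R, m ≤ R → HasDerivAt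
      (fun R : ℝ => 1 / 2 * Real.log ((R ^ 2 - w.re) ^ 2 + w.im ^ 2) - Real.log R) (p R) R := by
    intro R hR
    have hR0 : 0 < R := hm0.trans_le hR
    have hq := hQpos R hR
    have h1 : HasDerivAt (fun R : ℝ => (R ^ 2 - w.re) ^ 2 + w.im ^ 2)
        (2 * (R ^ 2 - w.re) * (2 * R)) R := by
      have := (((hasDerivAt_pow 2 R).sub_const w.re).pow 2).add_const (w.im ^ 2)
      refine this.congr_deriv ?_
      simp
    have h2 := ((h1.log hq.ne').const_mul (1 / 2)).sub (Real.hasDerivAt_log hR0.ne')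
    refine h2.congr_deriv ?_
    simp only [hp, hwsq]
    field_simp
    ring
  have hcont : ContinuousOn p (Set.Icc m 1) := by
    apply ContinuousOn.div
    · fun_prop
    · fun_prop
    · intro R hR
      exact (mul_pos (hm0.trans_le hR.1) (hQpos R hR.1)).ne'
  have hftc : ∫ R in m..1, p R = (1 / 2 * Real.log ((1 ^ 2 - w.re) ^ 2 + w.im ^ 2) - Real.log 1)
      - (1 / 2 * Real.log ((m ^ 2 - w.re) ^ 2 + w.im ^ 2) - Real.log m) := by
    apply intervalIntegral.integral_eq_sub_of_hasDerivAt
      (f := fun R : ℝ => 1 / 2 * Real.log ((R ^ 2 - w.re) ^ 2 + w.im ^ 2) - Real.log R)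
    · intro R hR
      rw [Set.uIcc_of_le hm1.le] at hR
      exact hderiv R hR.1
    · apply ContinuousOn.intervalIntegrable
      rwa [Set.uIcc_of_le hm1.le]
  have hrhs : ∫⁻ R in Set.Ioo ‖ζ‖ 1, (if ‖z‖ < R then ENNReal.ofReal (1 / R *
          ((1 - ‖(starRingEnd ℂ) ζ / (R:ℂ) ^ 2 * z‖ ^ 2) /
            ‖1 - (starRingEnd ℂ) ζ / (R:ℂ) ^ 2 * z‖ ^ 2)) else 0)
      = ∫⁻ R in Set.Ioo m 1, ENNReal.ofReal (p R) := by
    have : ∀ R ∈ Set.Ioo ‖ζ‖ 1, (if ‖z‖ < R then ENNReal.ofReal (1 / R *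
          ((1 - ‖(starRingEnd ℂ) ζ / (R:ℂ) ^ 2 * z‖ ^ 2) /
            ‖1 - (starRingEnd ℂ) ζ / (R:ℂ) ^ 2 * z‖ ^ 2)) else 0)
        = (Set.Ioi ‖z‖).indicator (fun R => ENNReal.ofReal (p R)) R := by
      intro R hR
      by_cases h : ‖z‖ < R
      · rw [if_pos h, Set.indicator_of_mem (show R ∈ Set.Ioi ‖z‖ from h)]
        congr 1
        have hmR : m ≤ R := max_le h.le hR.1.le
        have hR0 : 0 < R := hm0.trans_le hmR
        have hRc : (R:ℂ) ≠ 0 := by exact_mod_cast hR0.ne'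
        have e1 : (starRingEnd ℂ) ζ / (R:ℂ) ^ 2 * z = w / (R:ℂ) ^ 2 := by rw [hw]; ring
        have e2 : 1 - w / (R:ℂ) ^ 2 = ((R:ℂ) ^ 2 - w) / (R:ℂ) ^ 2 := by field_simp
        rw [e1, e2, norm_div, norm_div, div_pow, div_pow, hQ, norm_pow, Complex.norm_real,
          Real.norm_eq_abs, abs_of_pos hR0]
        have := hQpos R hmR
        simp only [hp]
        field_simp
      · rw [if_neg h, Set.indicator_of_notMem (by simpa using h)]
    rw [setLIntegral_congr_fun measurableSet_Ioo this, lintegral_indicator measurableSet_Ioi,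
      Measure.restrict_restrict measurableSet_Ioi]
    congr 2
    ext R
    simp only [Set.mem_inter_iff, Set.mem_Ioi, Set.mem_Ioo, hm, max_lt_iff]
    tauto
  rw [hrhs, ← ofReal_integral_eq_lintegral_ofReal]
  · congr 1
    rw [← integral_Ioc_eq_integral_Ioo, ← intervalIntegral.integral_of_le hm1.le, hftc]
    have hmz : ‖(m:ℂ) ^ 2 - w‖ = m * ‖ζ - z‖ := by
      rcases lt_or_gt_of_ne hne with h | h
      · have : m = ‖ζ‖ := max_eq_right h.le
        rw [this, ← Complex.conj_mul', hw, ← mul_sub, norm_mul, RCLike.norm_conj]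
      · have : m = ‖z‖ := max_eq_left h.le
        rw [this, ← Complex.conj_mul', hw, ← sub_mul, norm_mul, ← map_sub, RCLike.norm_conj,
          mul_comm, norm_sub_rev]
    have hzz : 0 < ‖ζ - z‖ := by
      rw [norm_pos_iff, sub_ne_zero]
      rintro rfl
      exact hne rfl
    have h1w : 0 < ‖1 - w‖ := by
      have := hQpos 1 hm1.le
      rw [← hQ] at this
      simp only [Complex.ofReal_one, one_pow] at this
      by_contra hc
      have : ‖1 - w‖ = 0 := le_antisymm (not_lt.1 hc) (norm_nonneg _)
      simp_all
    rw [← hQ, ← hQ, hmz, Real.log_pow, Real.log_pow, Complex.ofReal_one, one_pow, norm_div,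
      Real.log_div h1w.ne' hzz.ne', Real.log_mul hm0.ne' hzz.ne', Real.log_one]
    push_cast
    ring
  · exact (hcont.integrableOn_Icc).mono_set Set.Ioo_subset_Icc_self
  · exact (ae_restrict_iff' measurableSet_Ioo).2
      (Filter.Eventually.of_forall fun R hR => hp0 R hR.1.le)

lemma aux_interior (ζ : ℂ) (hζ : ‖ζ‖ < 1) (f : ℂ → ℂ) :
    locDir ζ f = ∫⁻ R in Set.Ioo ‖ζ‖ 1, ENNReal.ofReal (2 / (1 - ‖ζ‖ ^ 2) / R) *
      auxE ((starRingEnd ℂ) ζ / (R:ℂ) ^ 2) R f := by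
  have hc : 0 < 2 / (1 - ‖ζ‖ ^ 2) := by
    have : ‖ζ‖ ^ 2 < 1 := pow_lt_one₀ (norm_nonneg _) hζ (by norm_num)
    have : 0 < 1 - ‖ζ‖ ^ 2 := by linarith
    positivity
  set c := 2 / (1 - ‖ζ‖ ^ 2) with hcdef
  set K : ℝ → ℂ → ℝ≥0∞ := fun R z => if ‖z‖ < R then ENNReal.ofReal (1 / R *
          ((1 - ‖(starRingEnd ℂ) ζ / (R:ℂ) ^ 2 * z‖ ^ 2) /
            ‖1 - (starRingEnd ℂ) ζ / (R:ℂ) ^ 2 * z‖ ^ 2)) else 0 with hK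
  have hKm : Measurable (Function.uncurry K) := by
    apply Measurable.ite
    · exact measurableSet_lt (by fun_prop) (by fun_prop)
    · fun_prop
    · fun_prop
  have hdm : Measurable fun z => ENNReal.ofReal (c * ‖deriv f z‖ ^ 2 / π) := by
    have := measurable_deriv f
    fun_prop
  unfold locDir
  rw [if_pos hζ]
  have hae : ∀ᵐ z : ℂ ∂(volume : Measure ℂ), ‖z‖ ≠ ‖ζ‖ := by
    rw [ae_iff]
    have h0 := Measure.addHaar_sphere (volume : Measure ℂ) 0 ‖ζ‖
    refine measure_mono_null ?_ h0
    intro z hz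
    simpa using hz
  calc _ = ∫⁻ z in ball (0:ℂ) 1, ∫⁻ R in Set.Ioo ‖ζ‖ 1,
        ENNReal.ofReal (c * ‖deriv f z‖ ^ 2 / π) * K R z := by
        apply lintegral_congr_ae
        rw [Filter.EventuallyEq, ae_restrict_iff' measurableSet_ball]
        filter_upwards [hae] with z hz hzb
        rw [lintegral_const_mul' _ _ ENNReal.ofReal_ne_top,
          ← aux_log z ζ (mem_ball_zero_iff.1 hzb) hζ hz, ← ENNReal.ofReal_mul (by positivity)]
        congr 1
        ring
    _ = ∫⁻ R in Set.Ioo ‖ζ‖ 1, ∫⁻ z in ball (0:ℂ) 1,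
        ENNReal.ofReal (c * ‖deriv f z‖ ^ 2 / π) * K R z := by
        apply lintegral_lintegral_swap
        apply Measurable.aemeasurable
        exact (hdm.comp measurable_fst).mul (hKm.comp measurable_swap)
    _ = _ := by
        refine setLIntegral_congr_fun measurableSet_Ioo fun R hR => ?_
        have hR0 : 0 < R := (norm_nonneg _).trans_lt hR.1
        unfold auxE
        rw [← lintegral_const_mul' _ _ ENNReal.ofReal_ne_top]
        have hset : ball (0:ℂ) R = ball (0:ℂ) R ∩ ball (0:ℂ) 1 :=
          (Set.inter_eq_left.2 (ball_subset_ball hR.2.le)).symm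
        rw [hset, ← Measure.restrict_restrict measurableSet_ball,
          ← lintegral_indicator (μ := volume.restrict (ball (0:ℂ) 1)) measurableSet_ball]
        refine lintegral_congr fun z => ?_
        by_cases h : ‖z‖ < R
        · rw [Set.indicator_of_mem (mem_ball_zero_iff.2 h)]
          simp only [hK, if_pos h]
          rw [← ENNReal.ofReal_mul (by positivity), ← ENNReal.ofReal_mul (by positivity)]
          congr 1
          ring
        · rw [Set.indicator_of_notMem (by simpa using h)]
          simp only [hK, if_neg h, mul_zero]

lemma aux_boundary (ζ : ℂ) (hζ : ‖ζ‖ = 1) (f : ℂ → ℂ) :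
    locDir ζ f = auxE ((starRingEnd ℂ) ζ) 1 f := by
  unfold locDir auxE
  rw [if_neg (by rw [hζ]; exact lt_irrefl _)]
  refine lintegral_congr fun z => ?_
  have h1 : ‖(starRingEnd ℂ) ζ * z‖ = ‖z‖ := by
    rw [norm_mul, RCLike.norm_conj, hζ, one_mul]
  have h2 : ‖1 - (starRingEnd ℂ) ζ * z‖ = ‖ζ - z‖ := by
    have : (starRingEnd ℂ) ζ * ζ = 1 := by
      rw [Complex.conj_mul', hζ]; simp
    rw [← this, ← mul_sub, norm_mul, RCLike.norm_conj, hζ, one_mul]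
  rw [h1, h2]

lemma aux_locDir (ζ : ℂ) (hζ : ‖ζ‖ ≤ 1) (f : ℂ → ℂ)
    (hf : DifferentiableOn ℂ f (ball (0:ℂ) 1)) (r : ℝ) (hr : 0 ≤ r) (hr1 : r < 1) :
    locDir ζ (fun z => f ((r:ℂ) * z)) ≤ ENNReal.ofReal r * locDir ζ f := by
  rcases hζ.lt_or_eq with h | h
  · rw [aux_interior ζ h, aux_interior ζ h, ← lintegral_const_mul' _ _ ENNReal.ofReal_ne_top]
    refine setLIntegral_mono' measurableSet_Ioo fun R hR => ?_
    have hR0 : 0 < R := (norm_nonneg _).trans_lt hR.1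
    rw [mul_left_comm]
    gcongr
    refine auxE_le _ R hR0 hR.2.le ?_ f hf r hr hr1
    rw [norm_div, RCLike.norm_conj, norm_pow, Complex.norm_real, Real.norm_eq_abs,
      abs_of_pos hR0]
    have : ‖ζ‖ / R ^ 2 * R = ‖ζ‖ / R := by field_simp
    rw [this, div_le_one hR0]
    exact hR.1.le
  · rw [aux_boundary ζ h, aux_boundary ζ h]
    exact auxE_le _ 1 one_pos le_rfl (by rw [RCLike.norm_conj, h, one_mul]) f hf r hr hr1

/-- For every `ζ` in the closed unit disk, `0 ≤ r < 1` and `f ∈ H²`,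
`D_ζ(f_r) ≤ (2r/(1+r)) D_ζ(f)` where `f_r(z) = f(rz)`; consequently, for every finite
positive Borel measure `μ` on the closed unit disk,
`D_μ(f_r) ≤ (2r/(1+r)) D_μ(f)` where `D_μ(f) = ∫ D_ζ(f) dμ(ζ)`. -/
theorem stmt_17 (f : ℂ → ℂ) (hf : MemH2 f) (r : ℝ) (hr0 : 0 ≤ r) (hr1 : r < 1) :
    (∀ ζ ∈ closedBall (0 : ℂ) 1,
      locDir ζ (fun z => f ((r : ℂ) * z)) ≤ ENNReal.ofReal (2 * r / (1 + r)) * locDir ζ f) ∧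
    ∀ μ : Measure ℂ, IsFiniteMeasure μ → μ (closedBall (0 : ℂ) 1)ᶜ = 0 →
      (∫⁻ ζ, locDir ζ (fun z => f ((r : ℂ) * z)) ∂μ)
        ≤ ENNReal.ofReal (2 * r / (1 + r)) * ∫⁻ ζ, locDir ζ f ∂μ := by
  have key : ∀ ζ ∈ closedBall (0 : ℂ) 1,
      locDir ζ (fun z => f ((r : ℂ) * z)) ≤ ENNReal.ofReal (2 * r / (1 + r)) * locDir ζ f := by
    intro ζ hζ
    refine (aux_locDir ζ (mem_closedBall_zero_iff.1 hζ) f hf.1 r hr0 hr1).trans ?_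
    gcongr
    rw [le_div_iff₀ (by linarith)]
    nlinarith
  refine ⟨key, fun μ _ hμ => ?_⟩
  rw [← lintegral_const_mul' _ _ ENNReal.ofReal_ne_top]
  refine lintegral_mono_ae ?_
  have hae : ∀ᵐ ζ ∂μ, ζ ∈ closedBall (0 : ℂ) 1 := by
    rw [ae_iff]
    exact hμ
  filter_upwards [hae] with ζ hζ
  exact key ζ hζ
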